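/- arXiv:2207.11542 — 9 statements merged into one kernel-verified Lean document; each statement's English description precedes it below -/
import Mathlib

section
/- Let G = (V, E) be a finite simple undirected graph on V = {1,…,n} with positive vertex weights w_i > 0, let β_{ij} ≥ 0 for each edge (i,j) ∈ E, and define the energy f(x) = −Σ_{i=1}^n w_i x_i + Σ_{(i,j)∈E} β_{ij} x_i x_j for x ∈ {0,1}^n. If β_{ij} ≥ min{w_i, w_j} for all (i,j) ∈ E, then for any x ∈ {0,1}^n there exists x' ∈ {0,1}^n with x'_i x'_j = 0 for every edge (i,j) ∈ E (i.e., x' is the indicator vector of an independent set) such that f(x') ≤ f(x). -/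
/-- Removing from `x` an endpoint `k` of a conflicting edge `(a, b)` whose weight is at most the
penalty of that edge does not increase the energy. -/
theorem energy_update_zero_le {n : ℕ} {G : SimpleGraph (Fin n)} [DecidableRel G.Adj]
    (w : Fin n → ℝ) {β : Fin n → Fin n → ℝ} (hβ0 : ∀ i j, G.Adj i j → 0 ≤ β i j)
    {x : Fin n → ℝ} (hx : ∀ i, 0 ≤ x i) {a b k : Fin n} (hab : a < b) (hadj : G.Adj a b)
    (ha : x a = 1) (hb : x b = 1) (hk : k = a ∨ k = b) (hwk : w k ≤ β a b) :
    -(∑ i, w i * Function.update x k 0 i) +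
        (∑ i, ∑ j, if i < j ∧ G.Adj i j then
          β i j * Function.update x k 0 i * Function.update x k 0 j else 0) ≤
      -(∑ i, w i * x i) + ∑ i, ∑ j, if i < j ∧ G.Adj i j then β i j * x i * x j else 0 := by
  have hxk : x k = 1 := by rcases hk with rfl | rfl <;> assumption
  set y := Function.update x k 0 with hy
  have hyk : y k = 0 := by simp [hy]
  have hy0 : ∀ i, 0 ≤ y i := fun i => by
    by_cases h : i = k
    · rw [h, hyk]
    · simpa [hy, h] using hx i
  have hyx : ∀ i, y i ≤ x i := fun i => by
    by_cases h : i = k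
    · rw [h, hyk, hxk]; exact zero_le_one
    · simp [hy, h]
  have hlin : ∑ i, w i * x i = ∑ i, w i * y i + w k := by
    have : ∀ i, w i * x i = w i * y i + if i = k then w k else 0 := fun i => by
      by_cases h : i = k
      · subst h; simp [hyk, hxk]
      · simp [hy, h]
    rw [Finset.sum_congr rfl fun i _ => this i, Finset.sum_add_distrib]
    simp
  have hquad : (∑ i, ∑ j, if i < j ∧ G.Adj i j then β i j * y i * y j else 0) + β a b ≤
      ∑ i, ∑ j, if i < j ∧ G.Adj i j then β i j * x i * x j else 0 := by
    have hsingle : β a b = ∑ i, ∑ j, if i = a ∧ j = b then β a b else 0 := by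
      simp [ite_and]
    rw [hsingle, ← Finset.sum_add_distrib]
    refine Finset.sum_le_sum fun i _ => ?_
    rw [← Finset.sum_add_distrib]
    refine Finset.sum_le_sum fun j _ => ?_
    by_cases hp : i = a ∧ j = b
    · obtain ⟨rfl, rfl⟩ := hp
      rcases hk with rfl | rfl <;> simp [hab, hadj, ha, hb, hyk]
    · rw [if_neg hp, add_zero]
      split_ifs with he
      · have := hβ0 i j he.2
        exact mul_le_mul (mul_le_mul_of_nonneg_left (hyx i) this) (hyx j) (hy0 j)
          (mul_nonneg this (hx i))
      · exact le_rfl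
  linarith

/-- For the penalized maximum independent set energy
f(x) = −Σ_i w_i x_i + Σ_{(i,j)∈E} β_{ij} x_i x_j with w_i > 0, β_{ij} ≥ 0 and
β_{ij} ≥ min{w_i, w_j} on every edge, every binary x can be improved to a binary x'
that is the indicator of an independent set with f(x') ≤ f(x). -/
theorem mis_energy_improvable (n : ℕ) (G : SimpleGraph (Fin n)) [DecidableRel G.Adj]
    (w : Fin n → ℝ) (hw : ∀ i, 0 < w i)
    (β : Fin n → Fin n → ℝ) (hβ0 : ∀ i j, G.Adj i j → 0 ≤ β i j)
    (hβ : ∀ i j, G.Adj i j → min (w i) (w j) ≤ β i j)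
    (f : (Fin n → ℝ) → ℝ)
    (hf : ∀ x, f x = -(∑ i, w i * x i) +
      ∑ i, ∑ j, if i < j ∧ G.Adj i j then β i j * x i * x j else 0)
    (x : Fin n → ℝ) (hx : ∀ i, x i = 0 ∨ x i = 1) :
    ∃ x' : Fin n → ℝ, (∀ i, x' i = 0 ∨ x' i = 1) ∧
      (∀ i j, G.Adj i j → x' i * x' j = 0) ∧ f x' ≤ f x := by
  induction hc : (Finset.univ.filter fun i => x i = 1).card using Nat.strong_induction_on
    generalizing x with
  | _ c ih =>
  by_cases hind : ∀ i j, G.Adj i j → x i * x j = 0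
  · exact ⟨x, hx, hind, le_rfl⟩
  obtain ⟨a, b, hab, hadj, ha, hb⟩ : ∃ a b, a < b ∧ G.Adj a b ∧ x a = 1 ∧ x b = 1 := by
    push Not at hind
    obtain ⟨i, j, hij, h⟩ := hind
    have hi := (hx i).resolve_left (left_ne_zero_of_mul h)
    have hj := (hx j).resolve_left (right_ne_zero_of_mul h)
    rcases lt_or_gt_of_ne hij.ne with hlt | hlt
    · exact ⟨i, j, hlt, hij, hi, hj⟩
    · exact ⟨j, i, hlt, hij.symm, hj, hi⟩
  obtain ⟨k, hk, hwk⟩ : ∃ k, (k = a ∨ k = b) ∧ w k ≤ β a b := by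
    rcases min_le_iff.mp (hβ a b hadj) with h | h
    · exact ⟨a, Or.inl rfl, h⟩
    · exact ⟨b, Or.inr rfl, h⟩
  have hxk : x k = 1 := by rcases hk with rfl | rfl <;> assumption
  have hle : f (Function.update x k 0) ≤ f x := by
    rw [hf, hf]
    refine energy_update_zero_le w hβ0 (fun i => ?_) hab hadj ha hb hk hwk
    rcases hx i with h | h <;> simp [h]
  have hbin : ∀ i, Function.update x k 0 i = 0 ∨ Function.update x k 0 i = 1 := fun i => by
    by_cases h : i = k
    · simp [h]
    · simpa [h] using hx i
  have hcard : (Finset.univ.filter fun i => Function.update x k 0 i = 1).card < c := by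
    rw [← hc]
    refine Finset.card_lt_card (Finset.ssubset_iff_of_subset (fun i => ?_) |>.mpr
      ⟨k, by simp [hxk], by simp⟩)
    by_cases h : i = k <;> simp [h]
  obtain ⟨x', hx', hind', hle'⟩ := ih _ hcard _ hbin rfl
  exact ⟨x', hx', hind', hle'.trans hle⟩
end

section
/- Let G = (V, E) be a finite simple undirected graph on V = {1,…,n} with positive vertex weights w_i > 0, penalties β_{ij} ≥ 0 satisfying β_{ij} ≥ min{w_i, w_j} for all edges, and energy f(x) = −Σ_{i=1}^n w_i x_i + Σ_{(i,j)∈E} β_{ij} x_i x_j. Suppose x ∈ {0,1}^n violates some constraint, i.e., there is an edge (i,j) ∈ E with x_i = x_j = 1. Let k ∈ {i,j} attain min{w_i, w_j} and let x' be obtained from x by setting coordinate k to 0 (x'_l = x_l for l ≠ k, x'_k = 0). Then f(x') ≤ f(x), and the set of violated edges of x' (edges (a,b) with x'_a x'_b = 1) is a strict subset of the set of violated edges of x. -/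
/-- One greedy repair step for the maximum independent set energy: if x violates an
edge (i,j) (x_i = x_j = 1) and k ∈ {i,j} attains min{w_i, w_j}, then setting
coordinate k to 0 does not increase the energy, and the set of violated edges
strictly decreases. -/
theorem mis_repair_step (n : ℕ) (G : SimpleGraph (Fin n)) [DecidableRel G.Adj]
    (w : Fin n → ℝ) (hw : ∀ i, 0 < w i)
    (β : Fin n → Fin n → ℝ) (hβ0 : ∀ i j, G.Adj i j → 0 ≤ β i j)
    (hβ : ∀ i j, G.Adj i j → min (w i) (w j) ≤ β i j)
    (f : (Fin n → ℝ) → ℝ)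
    (hf : ∀ x, f x = -(∑ i, w i * x i) +
      ∑ i, ∑ j, if i < j ∧ G.Adj i j then β i j * x i * x j else 0)
    (x : Fin n → ℝ) (hx : ∀ i, x i = 0 ∨ x i = 1)
    (i j : Fin n) (hij : G.Adj i j) (hxi : x i = 1) (hxj : x j = 1)
    (k : Fin n) (hk : k = i ∨ k = j) (hwk : w k = min (w i) (w j))
    (x' : Fin n → ℝ) (hx' : x' = Function.update x k 0) :
    f x' ≤ f x ∧
      {p : Fin n × Fin n | G.Adj p.1 p.2 ∧ x' p.1 = 1 ∧ x' p.2 = 1} ⊂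
        {p : Fin n × Fin n | G.Adj p.1 p.2 ∧ x p.1 = 1 ∧ x p.2 = 1} := by
  subst hx'
  have hxk : x k = 1 := by rcases hk with rfl | rfl <;> assumption
  have hle : ∀ a, Function.update x k 0 a ≤ x a := by
    intro a
    by_cases h : a = k
    · subst h; simp [hxk]
    · simp [h]
  have hnonneg : ∀ a, 0 ≤ Function.update x k 0 a := by
    intro a
    by_cases h : a = k
    · subst h; simp
    · rcases hx a with h' | h' <;> simp [h, h']
  constructor
  · obtain ⟨a, b, hab, hadj, hxa, hxb, hkab, hwβ⟩ : ∃ a b, a < b ∧ G.Adj a b ∧ x a = 1 ∧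
        x b = 1 ∧ (k = a ∨ k = b) ∧ w k ≤ β a b := by
      rcases lt_or_gt_of_ne hij.ne with h | h
      · exact ⟨i, j, h, hij, hxi, hxj, hk, hwk ▸ hβ i j hij⟩
      · exact ⟨j, i, h, hij.symm, hxj, hxi, hk.symm, by
          rw [hwk, min_comm]; exact hβ j i hij.symm⟩
    have hlin : ∑ l, w l * x l = ∑ l, w l * Function.update x k 0 l + w k := by
      have : ∀ l, w l * x l = w l * Function.update x k 0 l + if l = k then w k else 0 := by
        intro l
        by_cases h : l = k
        · subst h; simp [hxk]
        · simp [h]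
      simp_rw [this, Finset.sum_add_distrib]
      simp
    have hquad : (∑ c, ∑ d, if c < d ∧ G.Adj c d then
          β c d * Function.update x k 0 c * Function.update x k 0 d else 0) + w k ≤
        ∑ c, ∑ d, if c < d ∧ G.Adj c d then β c d * x c * x d else 0 := by
      have hsum : w k = ∑ c, ∑ d, if c = a ∧ d = b then w k else 0 := by
        simp [ite_and]
      conv_lhs => rw [hsum]
      simp_rw [← Finset.sum_add_distrib]
      refine Finset.sum_le_sum fun c _ => Finset.sum_le_sum fun d _ => ?_
      by_cases h : c = a ∧ d = b
      · obtain ⟨rfl, rfl⟩ := h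
        rcases hkab with rfl | rfl <;> simpa [hab, hadj, hxa, hxb] using hwβ
      · rw [if_neg h, add_zero]
        split_ifs with hcd
        · rw [mul_assoc, mul_assoc]
          exact mul_le_mul_of_nonneg_left
            (mul_le_mul (hle c) (hle d) (hnonneg d) ((hnonneg c).trans (hle c)))
            (hβ0 c d hcd.2)
        · exact le_rfl
    rw [hf, hf]
    linarith
  · have hone : ∀ a, Function.update x k 0 a = 1 → x a = 1 := by
      intro a ha
      by_cases h : a = k
      · subst h; exact hxk
      · simpa [h] using ha
    rw [Set.ssubset_iff_exists]
    refine ⟨fun p hp => ⟨hp.1, hone _ hp.2.1, hone _ hp.2.2⟩,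
      (i, j), ⟨hij, hxi, hxj⟩, ?_⟩
    rintro ⟨-, h1, h2⟩
    rcases hk with rfl | rfl
    · simp at h1
    · simp at h2
end

section
/- Let G = (V, E) be a finite simple undirected graph on V = {1,…,n} with positive vertex weights w_i > 0 and penalties satisfying the strict inequality β_{ij} > min{w_i, w_j} for all edges (i,j) ∈ E, and define f(x) = −Σ_{i=1}^n w_i x_i + Σ_{(i,j)∈E} β_{ij} x_i x_j. Then every minimizer of f over {0,1}^n is the indicator vector of an independent set of G; i.e., the energy f is unbiased. -/
/-- Removing a selected vertex `k` lowers the linear part of the energy by its weight. -/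
theorem sum_weight_update_false {n : ℕ} (w : Fin n → ℝ) (x : Fin n → Bool) (k : Fin n)
    (hk : x k = true) :
    ∑ i, w i * (if x i then 1 else 0) =
      ∑ i, w i * (if Function.update x k false i then 1 else 0) + w k := by
  rw [← Finset.add_sum_erase _ _ (Finset.mem_univ k),
    ← Finset.add_sum_erase Finset.univ
      (fun i => w i * (if Function.update x k false i then 1 else 0)) (Finset.mem_univ k)]
  have h : ∀ i ∈ Finset.univ.erase k,
      w i * (if Function.update x k false i then 1 else 0) = w i * (if x i then 1 else 0) := by
    intro i hi
    rw [Function.update_of_ne (Finset.ne_of_mem_erase hi)]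
  rw [Finset.sum_congr rfl h]
  simp [hk, add_comm]

/-- Removing an endpoint `k` of a selected edge `a < b` lowers the penalty part of the energy by
at least `β a b`. -/
theorem sum_penalty_update_false_le {n : ℕ} (G : SimpleGraph (Fin n)) [DecidableRel G.Adj]
    (β : Fin n → Fin n → ℝ) (hβ0 : ∀ i j, G.Adj i j → 0 ≤ β i j) (x : Fin n → Bool)
    {a b k : Fin n} (hlt : a < b) (hab : G.Adj a b) (ha : x a = true) (hb : x b = true)
    (hk : k = a ∨ k = b) :
    (∑ i, ∑ j, if i < j ∧ G.Adj i j ∧ Function.update x k false i ∧ Function.update x k false j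
        then β i j else 0) + β a b ≤
      ∑ i, ∑ j, if i < j ∧ G.Adj i j ∧ x i ∧ x j then β i j else 0 := by
  have hsingle : β a b = ∑ i, ∑ j, if i = a ∧ j = b then β a b else 0 := by
    simp [ite_and]
  have hupd : ∀ i, Function.update x k false i = true → i ≠ k ∧ x i = true := by
    intro i hi
    by_cases hik : i = k
    · simp [hik] at hi
    · exact ⟨hik, by simpa [hik] using hi⟩
  rw [hsingle]
  simp only [← Finset.sum_add_distrib]
  refine Finset.sum_le_sum fun i _ => Finset.sum_le_sum fun j _ => ?_
  by_cases hij : i = a ∧ j = b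
  · obtain ⟨rfl, rfl⟩ := hij
    have hnot : ¬(i < j ∧ G.Adj i j ∧ Function.update x k false i = true ∧
        Function.update x k false j = true) := by
      rintro ⟨-, -, hi, hj⟩
      rcases hk with h | h
      · exact (hupd i hi).1 h.symm
      · exact (hupd j hj).1 h.symm
    rw [if_neg hnot]
    simp [hlt, hab, ha, hb]
  · rw [if_neg hij, add_zero]
    split_ifs with h1 h2 h2
    · exact le_rfl
    · exact absurd ⟨h1.1, h1.2.1, (hupd i h1.2.2.1).2, (hupd j h1.2.2.2).2⟩ h2
    · exact hβ0 i j h2.2.1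
    · exact le_rfl


/-- With strict penalties β_{ij} > min{w_i, w_j} on every edge, every minimizer of the
penalized maximum independent set energy over {0,1}^n is the indicator vector of an
independent set: the energy is unbiased. -/
theorem mis_energy_unbiased (n : ℕ) (G : SimpleGraph (Fin n)) [DecidableRel G.Adj]
    (w : Fin n → ℝ) (hw : ∀ i, 0 < w i)
    (β : Fin n → Fin n → ℝ) (hβ0 : ∀ i j, G.Adj i j → 0 ≤ β i j)
    (hβ : ∀ i j, G.Adj i j → min (w i) (w j) < β i j)
    (f : (Fin n → Bool) → ℝ)
    (hf : ∀ x, f x = -(∑ i, w i * (if x i then 1 else 0)) +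
      ∑ i, ∑ j, if i < j ∧ G.Adj i j ∧ x i ∧ x j then β i j else 0)
    (x : Fin n → Bool) (hmin : ∀ y : Fin n → Bool, f x ≤ f y) :
    ∀ i j, G.Adj i j → ¬(x i = true ∧ x j = true) := by
  have key : ∀ a b, a < b → G.Adj a b → ¬(x a = true ∧ x b = true) := by
    rintro a b hlt hab ⟨ha, hb⟩
    obtain ⟨k, hk, hxk, hwk⟩ : ∃ k, (k = a ∨ k = b) ∧ x k = true ∧ w k < β a b := by
      rcases min_lt_iff.mp (hβ a b hab) with h | h
      · exact ⟨a, Or.inl rfl, ha, h⟩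
      · exact ⟨b, Or.inr rfl, hb, h⟩
    have hle := hmin (Function.update x k false)
    rw [hf, hf] at hle
    have hlin := sum_weight_update_false w x k hxk
    have hquad := sum_penalty_update_false_le G β hβ0 x hlt hab ha hb hk
    linarith
  rintro i j hadj ⟨hi, hj⟩
  rcases lt_or_gt_of_ne hadj.ne with h | h
  · exact key i j h hadj ⟨hi, hj⟩
  · exact key j i h hadj.symm ⟨hj, hi⟩
end

section
/- Let G = (V, E) be a finite simple undirected graph on V = {1,…,n} with positive vertex weights w_i > 0, let E^c = {(i,j) : i ≠ j, (i,j) ∉ E} be the set of non-edges, let β_{ij} ≥ 0 for (i,j) ∈ E^c, and define the energy f(x) = −Σ_{i=1}^n w_i x_i + Σ_{(i,j)∈E^c} β_{ij} x_i x_j for x ∈ {0,1}^n. If β_{ij} ≥ min{w_i, w_j} for all (i,j) ∈ E^c, then for any x ∈ {0,1}^n there exists x' ∈ {0,1}^n with x'_i x'_j = 0 for every (i,j) ∈ E^c (i.e., x' is the indicator vector of a clique) such that f(x') ≤ f(x). -/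
/-- Switching off one endpoint `k` of a violated non-edge `(a, b)` whose penalty is at least `w k`
does not increase the penalized clique energy. -/
theorem clique_energy_update_le {n : ℕ} (G : SimpleGraph (Fin n)) [DecidableRel G.Adj]
    (w : Fin n → ℝ) (β : Fin n → Fin n → ℝ)
    (hβ0 : ∀ i j, i ≠ j → ¬G.Adj i j → 0 ≤ β i j)
    (x : Fin n → ℝ) (hx : ∀ i, x i = 0 ∨ x i = 1)
    {a b k : Fin n} (hab : a < b) (hadj : ¬G.Adj a b) (ha : x a = 1) (hb : x b = 1)
    (hk : k = a ∨ k = b) (hwk : w k ≤ β a b) :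
    -(∑ i, w i * Function.update x k 0 i) +
      (∑ i, ∑ j, if i < j ∧ ¬G.Adj i j then
        β i j * Function.update x k 0 i * Function.update x k 0 j else 0) ≤
    -(∑ i, w i * x i) + ∑ i, ∑ j, if i < j ∧ ¬G.Adj i j then β i j * x i * x j else 0 := by
  have hxk : x k = 1 := by rcases hk with rfl | rfl <;> assumption
  have hx0 : ∀ i, 0 ≤ x i := fun i => by rcases hx i with h | h <;> simp [h]
  have hy0 : ∀ i, 0 ≤ Function.update x k 0 i := fun i => by
    by_cases h : i = k
    · simp [h]
    · simpa [h] using hx0 i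
  have hyx : ∀ i, Function.update x k 0 i ≤ x i := fun i => by
    by_cases h : i = k
    · simp [h, hxk]
    · simp [h]
  have hlin : ∑ i, w i * x i = (∑ i, w i * Function.update x k 0 i) + w k := by
    have hsingle : w k = ∑ i, if i = k then w k else 0 := by simp
    conv_rhs => rw [hsingle, ← Finset.sum_add_distrib]
    refine Finset.sum_congr rfl fun i _ => ?_
    by_cases h : i = k
    · subst h
      simp [hxk]
    · simp [h]
  have hsum : (∑ i, ∑ j, if i < j ∧ ¬G.Adj i j then
        β i j * Function.update x k 0 i * Function.update x k 0 j else 0) + β a b ≤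
      ∑ i, ∑ j, if i < j ∧ ¬G.Adj i j then β i j * x i * x j else 0 := by
    have hsingle : β a b = ∑ i, ∑ j, if i = a ∧ j = b then β a b else 0 := by
      simp [ite_and]
    conv_lhs => rw [hsingle]
    simp only [← Finset.sum_add_distrib]
    refine Finset.sum_le_sum fun i _ => Finset.sum_le_sum fun j _ => ?_
    by_cases h : i = a ∧ j = b
    · obtain ⟨rfl, rfl⟩ := h
      rcases hk with rfl | rfl <;> simp [hab, hadj, ha, hb]
    · rw [if_neg h, add_zero]
      split_ifs with hij
      · have := hβ0 i j hij.1.ne hij.2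
        exact mul_le_mul (mul_le_mul_of_nonneg_left (hyx i) this) (hyx j) (hy0 j)
          (mul_nonneg this (hx0 i))
      · exact le_rfl
  linarith

/-- For the penalized maximum clique energy
f(x) = −Σ_i w_i x_i + Σ_{(i,j)∈Eᶜ} β_{ij} x_i x_j with w_i > 0, β_{ij} ≥ 0 and
β_{ij} ≥ min{w_i, w_j} on every non-edge, every binary x can be improved to a binary
x' that is the indicator of a clique with f(x') ≤ f(x). -/
theorem clique_energy_improvable (n : ℕ) (G : SimpleGraph (Fin n)) [DecidableRel G.Adj]
    (w : Fin n → ℝ) (hw : ∀ i, 0 < w i)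
    (β : Fin n → Fin n → ℝ)
    (hβ0 : ∀ i j, i ≠ j → ¬G.Adj i j → 0 ≤ β i j)
    (hβ : ∀ i j, i ≠ j → ¬G.Adj i j → min (w i) (w j) ≤ β i j)
    (f : (Fin n → ℝ) → ℝ)
    (hf : ∀ x, f x = -(∑ i, w i * x i) +
      ∑ i, ∑ j, if i < j ∧ ¬G.Adj i j then β i j * x i * x j else 0)
    (x : Fin n → ℝ) (hx : ∀ i, x i = 0 ∨ x i = 1) :
    ∃ x' : Fin n → ℝ, (∀ i, x' i = 0 ∨ x' i = 1) ∧
      (∀ i j, i ≠ j → ¬G.Adj i j → x' i * x' j = 0) ∧ f x' ≤ f x := by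
  induction hm : (Finset.univ.filter fun i => x i = 1).card using Nat.strong_induction_on
    generalizing x with
  | _ m ih =>
    by_cases hc : ∀ i j, i ≠ j → ¬G.Adj i j → x i * x j = 0
    · exact ⟨x, hx, hc, le_rfl⟩
    obtain ⟨a, b, hab, hadj, ha, hb⟩ :
        ∃ a b, a < b ∧ ¬G.Adj a b ∧ x a = 1 ∧ x b = 1 := by
      push Not at hc
      obtain ⟨i, j, hij, hadj, hne⟩ := hc
      have hi := (hx i).resolve_left (left_ne_zero_of_mul hne)
      have hj := (hx j).resolve_left (right_ne_zero_of_mul hne)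
      rcases lt_or_gt_of_ne hij with h | h
      · exact ⟨i, j, h, hadj, hi, hj⟩
      · exact ⟨j, i, h, fun hji => hadj hji.symm, hj, hi⟩
    obtain ⟨k, hk, hwk⟩ : ∃ k, (k = a ∨ k = b) ∧ w k ≤ β a b := by
      rcases min_le_iff.mp (hβ a b hab.ne hadj) with h | h
      · exact ⟨a, Or.inl rfl, h⟩
      · exact ⟨b, Or.inr rfl, h⟩
    have hxk : x k = 1 := by rcases hk with rfl | rfl <;> assumption
    have hle : f (Function.update x k 0) ≤ f x := by
      rw [hf, hf]
      exact clique_energy_update_le G w β hβ0 x hx hab hadj ha hb hk hwk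
    have hy : ∀ i, Function.update x k 0 i = 0 ∨ Function.update x k 0 i = 1 := fun i => by
      by_cases h : i = k
      · simp [h]
      · simpa [h] using hx i
    have hcard : (Finset.univ.filter fun i => Function.update x k 0 i = 1).card < m := by
      rw [← hm]
      refine Finset.card_lt_card (Finset.ssubset_iff_of_subset ?_ |>.mpr ⟨k, ?_, ?_⟩)
      · intro i
        by_cases h : i = k <;> simp [h]
      · simp [hxk]
      · simp
    obtain ⟨z, hz, hzc, hzf⟩ := ih _ hcard _ hy rfl
    exact ⟨z, hz, hzc, hzf.trans hle⟩
end

section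
/- Let G = (V, E) be a finite simple undirected graph on V = {1,…,n} with positive vertex weights w_i > 0, non-edge set E^c = {(i,j) : i ≠ j, (i,j) ∉ E}, and penalties β_{ij} ≥ 0 satisfying β_{ij} ≥ min{w_i, w_j} for all (i,j) ∈ E^c, and define f(x) = −Σ_{i=1}^n w_i x_i + Σ_{(i,j)∈E^c} β_{ij} x_i x_j. Then min_{x ∈ {0,1}^n} f(x) = min { −Σ_{i∈S} w_i : S ⊆ V is a clique of G }; equivalently, the unconstrained minimum of the penalized energy equals the optimal value of the maximum weight clique problem. -/
/-- Deleting `u` from a set containing `u ≠ v` lowers the sum of a nonnegative kernel over pairs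
by at least `g u v + g v u`. -/
theorem sum_sum_erase_add_le {ι : Type*} [DecidableEq ι] (g : ι → ι → ℝ)
    (hg : ∀ i j, 0 ≤ g i j) (T : Finset ι) {u v : ι} (hu : u ∈ T) (hv : v ∈ T) (huv : u ≠ v) :
    (∑ i ∈ T.erase u, ∑ j ∈ T.erase u, g i j) + (g u v + g v u) ≤
      ∑ i ∈ T, ∑ j ∈ T, g i j := by
  have hv' : v ∈ T.erase u := Finset.mem_erase.2 ⟨huv.symm, hv⟩
  have hrow : g u v ≤ ∑ j ∈ T.erase u, g u j :=
    Finset.single_le_sum (f := fun j => g u j) (fun j _ => hg u j) hv'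
  have hcol : g v u ≤ ∑ i ∈ T.erase u, g i u :=
    Finset.single_le_sum (f := fun i => g i u) (fun i _ => hg i u) hv'
  have hsplit : ∀ i, ∑ j ∈ T, g i j = g i u + ∑ j ∈ T.erase u, g i j :=
    fun i => (Finset.add_sum_erase T (g i) hu).symm
  rw [← Finset.add_sum_erase T (fun i => ∑ j ∈ T, g i j) hu]
  simp only [hsplit, Finset.sum_add_distrib]
  linarith [hg u u]

/-- If the pair penalties of a nonadjacent pair dominate the smaller weight, every vertex set
contains a clique of no larger penalized energy. -/
theorem exists_clique_neg_sum_le {ι : Type*} [DecidableEq ι] (G : SimpleGraph ι) (w : ι → ℝ)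
    (g : ι → ι → ℝ) (hg : ∀ i j, 0 ≤ g i j)
    (hwg : ∀ i j, i ≠ j → ¬G.Adj i j → min (w i) (w j) ≤ g i j + g j i) (T : Finset ι) :
    ∃ S : Finset ι, (∀ i ∈ S, ∀ j ∈ S, i ≠ j → G.Adj i j) ∧
      -∑ i ∈ S, w i ≤ -∑ i ∈ T, w i + ∑ i ∈ T, ∑ j ∈ T, g i j := by
  induction T using Finset.strongInduction with
  | H T ih =>
    by_cases hT : ∀ i ∈ T, ∀ j ∈ T, i ≠ j → G.Adj i j
    · exact ⟨T, hT, le_add_of_nonneg_right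
        (Finset.sum_nonneg fun i _ => Finset.sum_nonneg fun j _ => hg i j)⟩
    obtain ⟨u, hu, v, hv, huv, hw⟩ :
        ∃ u ∈ T, ∃ v ∈ T, u ≠ v ∧ w u ≤ g u v + g v u := by
      push Not at hT
      obtain ⟨i, hi, j, hj, hij, hadj⟩ := hT
      have h := hwg i j hij hadj
      rcases le_total (w i) (w j) with hle | hle
      · exact ⟨i, hi, j, hj, hij, by rwa [min_eq_left hle] at h⟩
      · exact ⟨j, hj, i, hi, hij.symm, by rw [min_eq_right hle] at h; linarith⟩
    obtain ⟨S, hS, hle⟩ := ih (T.erase u) (Finset.erase_ssubset hu)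
    refine ⟨S, hS, hle.trans ?_⟩
    have hsum := Finset.add_sum_erase T w hu
    linarith [sum_sum_erase_add_le g hg T hu hv huv]

/-- With β_{ij} ≥ min{w_i, w_j} on every non-edge, the unconstrained minimum of the
penalized maximum clique energy over {0,1}^n equals the optimal value
min { −Σ_{i∈S} w_i : S a clique } of the maximum weight clique problem. -/
theorem clique_energy_min_eq (n : ℕ) (G : SimpleGraph (Fin n)) [DecidableRel G.Adj]
    (w : Fin n → ℝ) (hw : ∀ i, 0 < w i)
    (β : Fin n → Fin n → ℝ)
    (hβ0 : ∀ i j, i ≠ j → ¬G.Adj i j → 0 ≤ β i j)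
    (hβ : ∀ i j, i ≠ j → ¬G.Adj i j → min (w i) (w j) ≤ β i j)
    (f : (Fin n → Bool) → ℝ)
    (hf : ∀ x, f x = -(∑ i, w i * (if x i then 1 else 0)) +
      ∑ i, ∑ j, if i < j ∧ ¬G.Adj i j ∧ x i ∧ x j then β i j else 0) :
    (⨅ x : Fin n → Bool, f x) =
      ⨅ S : {S : Finset (Fin n) // ∀ i ∈ S, ∀ j ∈ S, i ≠ j → G.Adj i j},
        -∑ i ∈ S.1, w i := by
  set g : Fin n → Fin n → ℝ := fun i j => if i < j ∧ ¬G.Adj i j then β i j else 0 with hgdef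
  have hg : ∀ i j, 0 ≤ g i j := fun i j => by
    simp only [hgdef]
    split_ifs with h
    · exact hβ0 i j h.1.ne h.2
    · exact le_rfl
  have hwg : ∀ i j, i ≠ j → ¬G.Adj i j → min (w i) (w j) ≤ g i j + g j i := by
    intro i j hij hadj
    have hadj' : ¬G.Adj j i := fun h => hadj h.symm
    rcases lt_or_gt_of_ne hij with h | h
    · simpa [hgdef, h, h.not_gt, hadj] using hβ i j hij hadj
    · simpa [hgdef, h, h.not_gt, hadj', min_comm] using hβ j i hij.symm hadj'
  have hfT : ∀ x, f x = -∑ i ∈ Finset.univ.filter (fun i => x i = true), w i +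
      ∑ i ∈ Finset.univ.filter (fun i => x i = true),
        ∑ j ∈ Finset.univ.filter (fun i => x i = true), g i j := by
    intro x
    rw [hf x]
    simp only [Finset.sum_filter, mul_ite, mul_one, mul_zero]
    congr 1
    refine Finset.sum_congr rfl fun i _ => ?_
    by_cases hi : x i = true
    · rw [if_pos hi]
      refine Finset.sum_congr rfl fun j _ => ?_
      by_cases hj : x j = true <;> simp [hgdef, hi, hj]
    · simp [hi]
  have : Nonempty {S : Finset (Fin n) // ∀ i ∈ S, ∀ j ∈ S, i ≠ j → G.Adj i j} :=
    ⟨⟨∅, by simp⟩⟩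
  apply le_antisymm
  · refine le_ciInf fun ⟨S, hS⟩ => ciInf_le_of_le (Set.finite_range f).bddBelow
      (fun i => decide (i ∈ S)) ?_
    have hpen : ∑ i ∈ S, ∑ j ∈ S, g i j = 0 :=
      Finset.sum_eq_zero fun i hi => Finset.sum_eq_zero fun j hj =>
        if_neg fun h => h.2 (hS i hi j hj h.1.ne)
    rw [hfT]
    simp [hpen]
  · refine le_ciInf fun x => ?_
    obtain ⟨S, hS, hle⟩ := exists_clique_neg_sum_le G w g hg hwg
      (Finset.univ.filter fun i => x i = true)
    exact ciInf_le_of_le (Set.finite_range _).bddBelow ⟨S, hS⟩ (hle.trans_eq (hfT x).symm)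
end

section
/- Let G = (V, E) be a finite simple undirected graph on V = {1,…,n} with positive vertex weights w_i > 0, let N(i) denote the neighborhood of vertex i, let β_i ≥ 0, and define the energy f(x) = Σ_{i=1}^n w_i x_i + Σ_{i=1}^n β_i (1 − x_i) Π_{j∈N(i)} (1 − x_j) for x ∈ {0,1}^n. If β_i ≥ min{ w_k : k ∈ N(i) or k = i } for every i ∈ V, then for any x ∈ {0,1}^n there exists x' ∈ {0,1}^n with (1 − x'_i) Π_{j∈N(i)} (1 − x'_j) = 0 for every i ∈ V (i.e., x' is the indicator vector of a dominating set) such that f(x') ≤ f(x). -/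
/-- Turning on a vertex `k` of the closed neighborhood of an undominated vertex `i` with
`w k ≤ β i` does not increase the penalized energy. -/
theorem energy_update_le {V : Type*} [Fintype V] [DecidableEq V] (G : SimpleGraph V)
    [DecidableRel G.Adj] (w β : V → ℝ) (hβ0 : ∀ i, 0 ≤ β i) (x : V → ℝ)
    (hx : ∀ i, x i = 0 ∨ x i = 1) {i k : V} (hk : k ∈ insert i (G.neighborFinset i))
    (hwk : w k ≤ β i) (hz : ∀ j ∈ insert i (G.neighborFinset i), x j = 0) :
    (∑ j, w j * Function.update x k 1 j) +
        ∑ j, β j * (1 - Function.update x k 1 j) *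
          ∏ l ∈ G.neighborFinset j, (1 - Function.update x k 1 l) ≤
      (∑ j, w j * x j) + ∑ j, β j * (1 - x j) * ∏ l ∈ G.neighborFinset j, (1 - x l) := by
  set y := Function.update x k 1 with hy
  have hyk : y k = 1 := by simp [hy]
  have hy0 : ∀ j, 0 ≤ 1 - y j := by
    intro j
    by_cases h : j = k
    · simp [h, hyk]
    · rcases hx j with h' | h' <;> simp [hy, h, h']
  have hle : ∀ j, 1 - y j ≤ 1 - x j := by
    intro j
    by_cases h : j = k
    · rcases hx k with h' | h' <;> simp [h, hyk, h']
    · simp [hy, h]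
  have hterm : ∀ j, β j * (1 - y j) * ∏ l ∈ G.neighborFinset j, (1 - y l) ≤
      β j * (1 - x j) * ∏ l ∈ G.neighborFinset j, (1 - x l) := fun j ↦
    mul_le_mul (mul_le_mul_of_nonneg_left (hle j) (hβ0 j))
      (Finset.prod_le_prod (fun l _ ↦ hy0 l) fun l _ ↦ hle l)
      (Finset.prod_nonneg fun l _ ↦ hy0 l)
      (mul_nonneg (hβ0 j) ((hy0 j).trans (hle j)))
  have hyi : β i * (1 - y i) * ∏ l ∈ G.neighborFinset i, (1 - y l) = 0 := by
    rcases Finset.mem_insert.mp hk with h | h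
    · simp [← h, hyk]
    · rw [Finset.prod_eq_zero h (by simp [hyk]), mul_zero]
  have hxi : β i * (1 - x i) * ∏ l ∈ G.neighborFinset i, (1 - x l) = β i := by
    rw [Finset.prod_eq_one fun l hl ↦ by simp [hz l (Finset.mem_insert_of_mem hl)],
      hz i (Finset.mem_insert_self _ _)]
    ring
  have hweight : ∑ j, w j * y j = (∑ j, w j * x j) + w k := by
    rw [← Finset.add_sum_erase _ _ (Finset.mem_univ k),
      ← Finset.add_sum_erase _ (fun j ↦ w j * x j) (Finset.mem_univ k), hyk, hz k hk,
      Finset.sum_congr rfl fun j hj ↦ by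
        rw [hy, Function.update_of_ne (Finset.ne_of_mem_erase hj)]]
    ring
  have hpenalty := Finset.sum_le_sum fun j (_ : j ∈ Finset.univ.erase i) ↦ hterm j
  rw [hweight,
    ← Finset.add_sum_erase _ (fun j ↦ β j * (1 - y j) * ∏ l ∈ G.neighborFinset j, (1 - y l))
      (Finset.mem_univ i), hyi,
    ← Finset.add_sum_erase _ (fun j ↦ β j * (1 - x j) * ∏ l ∈ G.neighborFinset j, (1 - x l))
      (Finset.mem_univ i), hxi]
  linarith

/-- For the penalized minimum dominating set energy
f(x) = Σ_i w_i x_i + Σ_i β_i (1 − x_i) Π_{j∈N(i)} (1 − x_j) with w_i > 0, β_i ≥ 0 and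
β_i ≥ min{w_k : k ∈ N(i) or k = i}, every binary x can be improved to a binary x'
that is the indicator of a dominating set with f(x') ≤ f(x). -/
theorem mds_energy_improvable (n : ℕ) (G : SimpleGraph (Fin n)) [DecidableRel G.Adj]
    (w : Fin n → ℝ) (hw : ∀ i, 0 < w i)
    (β : Fin n → ℝ) (hβ0 : ∀ i, 0 ≤ β i)
    (hβ : ∀ i, (insert i (G.neighborFinset i)).inf' (Finset.insert_nonempty _ _) w ≤ β i)
    (f : (Fin n → ℝ) → ℝ)
    (hf : ∀ x, f x = (∑ i, w i * x i) +
      ∑ i, β i * (1 - x i) * ∏ j ∈ G.neighborFinset i, (1 - x j))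
    (x : Fin n → ℝ) (hx : ∀ i, x i = 0 ∨ x i = 1) :
    ∃ x' : Fin n → ℝ, (∀ i, x' i = 0 ∨ x' i = 1) ∧
      (∀ i, (1 - x' i) * ∏ j ∈ G.neighborFinset i, (1 - x' j) = 0) ∧
      f x' ≤ f x := by
  induction hm : (Finset.univ.filter fun i ↦ x i = 0).card using Nat.strong_induction_on
    generalizing x with
  | _ m ih =>
    by_cases hdom : ∀ i, (1 - x i) * ∏ j ∈ G.neighborFinset i, (1 - x j) = 0
    · exact ⟨x, hx, hdom, le_rfl⟩
    obtain ⟨i, hi⟩ := not_forall.mp hdom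
    rw [← Finset.prod_insert (f := fun j ↦ 1 - x j) (G.notMem_neighborFinset_self i),
      Finset.prod_eq_zero_iff] at hi
    have hz : ∀ j ∈ insert i (G.neighborFinset i), x j = 0 := fun j hj ↦
      (hx j).resolve_right fun h ↦ hi ⟨j, hj, by simp [h]⟩
    obtain ⟨k, hk, hwk⟩ := (Finset.inf'_le_iff _).mp (hβ i)
    have hcard : (Finset.univ.filter fun j ↦ Function.update x k 1 j = 0).card < m := by
      rw [← hm]
      refine Finset.card_lt_card (Finset.ssubset_iff_of_subset ?_ |>.mpr
        ⟨k, by simp [hz k hk], by simp⟩)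
      intro j hj
      by_cases h : j = k <;> simp_all
    obtain ⟨x', hx', hdom', hle⟩ := ih _ hcard (Function.update x k 1)
      (fun j ↦ by by_cases h : j = k <;> simp [h, hx]) rfl
    refine ⟨x', hx', hdom', hle.trans ?_⟩
    rw [hf, hf]
    exact energy_update_le G w β hβ0 x hx hk hwk hz
end

section
/- Let G = (V, E) be a finite simple undirected graph on V = {1,…,n} with positive vertex weights w_i > 0 and penalties β_i ≥ 0 satisfying β_i ≥ min{ w_k : k ∈ N(i) or k = i } for every i, and define f(x) = Σ_{i=1}^n w_i x_i + Σ_{i=1}^n β_i (1 − x_i) Π_{j∈N(i)} (1 − x_j). Then min_{x ∈ {0,1}^n} f(x) = min { Σ_{i∈S} w_i : S ⊆ V is a dominating set of G }; equivalently, the unconstrained minimum of the penalized energy equals the optimal value of the minimum weight dominating set problem. -/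
/-- Vertices that are neither in `T` nor adjacent to a vertex of `T`. -/
def SimpleGraph.undominated {V : Type*} [Fintype V] [DecidableEq V] (G : SimpleGraph V)
    [DecidableRel G.Adj] (T : Finset V) : Finset V :=
  {i | i ∉ T ∧ ∀ j ∈ T, ¬ G.Adj i j}

/-- The penalized energy is the weight of the support plus the penalties of the vertices
that the support leaves undominated. -/
theorem mds_energy_eq {V : Type*} [Fintype V] [DecidableEq V] (G : SimpleGraph V)
    [DecidableRel G.Adj] (w β : V → ℝ) (x : V → Bool) :
    (∑ i, w i * (if x i then 1 else 0)) +
      ∑ i, β i * (1 - (if x i then 1 else 0)) *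
        ∏ j ∈ G.neighborFinset i, (1 - (if x j then 1 else 0)) =
      ∑ i with x i, w i + ∑ i ∈ G.undominated {i | x i}, β i := by
  congr 1
  · simp [Finset.sum_filter]
  · rw [SimpleGraph.undominated, Finset.sum_filter]
    refine Finset.sum_congr rfl fun i _ => ?_
    split_ifs with hi h h
    · simp [hi] at h
    · simp
    · rw [Finset.prod_eq_one]
      · simp
      · intro j hj
        have hxj : ¬ x j := fun hxj => h.2 j (by simpa using hxj) (by simpa using hj)
        simp [hxj]
    · have ⟨j, hxj, hij⟩ : ∃ j, x j ∧ G.Adj i j := by simpa [hi] using h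
      rw [Finset.prod_eq_zero (i := j) (by simpa using hij) (by simp [hxj]), mul_zero]

/-- If every penalty is at least some weight in the closed neighborhood, any vertex set can be
completed to a dominating set whose weight is at most the penalized energy. -/
theorem exists_dominating_sum_le {V : Type*} [Fintype V] [DecidableEq V] (G : SimpleGraph V)
    [DecidableRel G.Adj] (w β : V → ℝ) (hw : ∀ i, 0 ≤ w i)
    (hβ : ∀ i, (insert i (G.neighborFinset i)).inf' (Finset.insert_nonempty _ _) w ≤ β i)
    (T : Finset V) :
    ∃ S : Finset V, (∀ i, i ∈ S ∨ ∃ j ∈ S, G.Adj i j) ∧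
      ∑ i ∈ S, w i ≤ ∑ i ∈ T, w i + ∑ i ∈ G.undominated T, β i := by
  have hg : ∀ i, ∃ k, (k = i ∨ G.Adj i k) ∧ w k ≤ β i := fun i => by
    simpa [Finset.inf'_le_iff] using hβ i
  choose g hgmem hgle using hg
  refine ⟨T ∪ (G.undominated T).image g, fun i => ?_, ?_⟩
  · by_cases hi : i ∈ G.undominated T
    · have hgi : g i ∈ T ∪ (G.undominated T).image g :=
        Finset.mem_union_right _ (Finset.mem_image_of_mem g hi)
      rcases hgmem i with h | h
      · exact .inl (h ▸ hgi)
      · exact .inr ⟨g i, hgi, h⟩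
    · by_cases hT : i ∈ T
      · exact .inl (Finset.mem_union_left _ hT)
      · have ⟨j, hj, hij⟩ : ∃ j ∈ T, G.Adj i j := by
          simpa [SimpleGraph.undominated, hT] using hi
        exact .inr ⟨j, Finset.mem_union_left _ hj, hij⟩
  · have hunion := Finset.sum_union_inter (s₁ := T) (s₂ := (G.undominated T).image g) (f := w)
    have hinter := Finset.sum_nonneg fun i (_ : i ∈ T ∩ (G.undominated T).image g) => hw i
    have himage : ∑ i ∈ (G.undominated T).image g, w i ≤ ∑ i ∈ G.undominated T, w (g i) :=
      Finset.sum_image_le_of_nonneg fun i _ => hw i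
    have hpenalty := Finset.sum_le_sum fun i (_ : i ∈ G.undominated T) => hgle i
    linarith

/-- With β_i ≥ min{w_k : k ∈ N(i) or k = i} for every i, the unconstrained minimum of
the penalized minimum dominating set energy over {0,1}^n equals the optimal value
min { Σ_{i∈S} w_i : S a dominating set } of the minimum weight dominating set
problem. -/
theorem mds_energy_min_eq (n : ℕ) (G : SimpleGraph (Fin n)) [DecidableRel G.Adj]
    (w : Fin n → ℝ) (hw : ∀ i, 0 < w i)
    (β : Fin n → ℝ) (hβ0 : ∀ i, 0 ≤ β i)
    (hβ : ∀ i, (insert i (G.neighborFinset i)).inf' (Finset.insert_nonempty _ _) w ≤ β i)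
    (f : (Fin n → Bool) → ℝ)
    (hf : ∀ x, f x = (∑ i, w i * (if x i then 1 else 0)) +
      ∑ i, β i * (1 - (if x i then 1 else 0)) *
        ∏ j ∈ G.neighborFinset i, (1 - (if x j then 1 else 0))) :
    (⨅ x : Fin n → Bool, f x) =
      ⨅ S : {S : Finset (Fin n) // ∀ i, i ∈ S ∨ ∃ j ∈ S, G.Adj i j},
        ∑ i ∈ S.1, w i := by
  simp only [mds_energy_eq] at hf
  have : Nonempty {S : Finset (Fin n) // ∀ i, i ∈ S ∨ ∃ j ∈ S, G.Adj i j} :=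
    ⟨⟨Finset.univ, fun i => .inl (Finset.mem_univ i)⟩⟩
  apply le_antisymm
  · refine le_ciInf fun ⟨S, hS⟩ => ?_
    refine (ciInf_le (Set.finite_range f).bddBelow fun i => decide (i ∈ S)).trans ?_
    have hempty : G.undominated S = ∅ := by
      simpa [SimpleGraph.undominated, Finset.filter_eq_empty_iff, or_iff_not_imp_left] using hS
    simp [hf, hempty]
  · refine le_ciInf fun x => ?_
    obtain ⟨S, hS, hle⟩ := exists_dominating_sum_le G w β (fun i => (hw i).le) hβ {i | x i}
    rw [hf]
    exact (ciInf_le (Set.finite_range _).bddBelow ⟨S, hS⟩).trans hle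
end

section
/- Let G = (V, E) be a finite simple undirected graph on V = {1,…,n} with positive vertex weights w_i > 0 and penalties satisfying the strict inequality β_i > min{ w_k : k ∈ N(i) or k = i } for every i ∈ V, and define f(x) = Σ_{i=1}^n w_i x_i + Σ_{i=1}^n β_i (1 − x_i) Π_{j∈N(i)} (1 − x_j). Then every minimizer of f over {0,1}^n is the indicator vector of a dominating set of G; i.e., the energy f is unbiased. -/
/-- With strict penalties β_i > min{w_k : k ∈ N(i) or k = i} for every i, every
minimizer of the penalized minimum dominating set energy over {0,1}^n is the
indicator vector of a dominating set: the energy is unbiased. -/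
theorem mds_energy_unbiased (n : ℕ) (G : SimpleGraph (Fin n)) [DecidableRel G.Adj]
    (w : Fin n → ℝ) (hw : ∀ i, 0 < w i)
    (β : Fin n → ℝ) (hβ0 : ∀ i, 0 ≤ β i)
    (hβ : ∀ i, (insert i (G.neighborFinset i)).inf' (Finset.insert_nonempty _ _) w < β i)
    (f : (Fin n → Bool) → ℝ)
    (hf : ∀ x, f x = (∑ i, w i * (if x i then 1 else 0)) +
      ∑ i, β i * (1 - (if x i then 1 else 0)) *
        ∏ j ∈ G.neighborFinset i, (1 - (if x j then 1 else 0)))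
    (x : Fin n → Bool) (hmin : ∀ y : Fin n → Bool, f x ≤ f y) :
    ∀ i, x i = true ∨ ∃ j, G.Adj i j ∧ x j = true := by
  intro i
  by_contra! hi
  obtain ⟨hxi, hxN⟩ := hi
  obtain ⟨k, hk, hwk⟩ := (Finset.inf'_lt_iff _).mp (hβ i)
  have hxk : x k = false := by
    rcases Finset.mem_insert.mp hk with rfl | hk
    · simpa using hxi
    · simpa using hxN k ((G.mem_neighborFinset i k).mp hk)
  set y : Fin n → Bool := Function.update x k true with hy
  have hyk : y k = true := by simp [hy]
  have hne : ∀ j, j ≠ k → y j = x j := fun j hj => by simp [hy, hj]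
  have hle : ∀ j, (1 - (if y j then 1 else 0) : ℝ) ≤ 1 - (if x j then 1 else 0) := by
    intro j
    rcases eq_or_ne j k with rfl | hj
    · simp [hyk, hxk]
    · rw [hne j hj]
  have hnonneg : ∀ (z : Fin n → Bool) j, (0 : ℝ) ≤ 1 - (if z j then 1 else 0) := by
    intro z j
    split_ifs <;> norm_num
  have hlin : (∑ j, w j * (if y j then 1 else 0)) =
      (∑ j, w j * (if x j then 1 else 0)) + w k := by
    rw [← Finset.add_sum_erase _ _ (Finset.mem_univ k),
      ← Finset.add_sum_erase _ (fun j => w j * (if x j then 1 else 0)) (Finset.mem_univ k),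
      Finset.sum_congr rfl fun j hj => by rw [hne j (Finset.ne_of_mem_erase hj)]]
    simp [hyk, hxk, add_comm]
  set P : (Fin n → Bool) → Fin n → ℝ := fun z j => β j * (1 - (if z j then 1 else 0)) *
    ∏ l ∈ G.neighborFinset j, (1 - (if z l then 1 else 0)) with hP
  have hPle : ∀ j, P y j ≤ P x j := fun j =>
    mul_le_mul (mul_le_mul_of_nonneg_left (hle j) (hβ0 j))
      (Finset.prod_le_prod (fun l _ => hnonneg y l) (fun l _ => hle l))
      (Finset.prod_nonneg fun l _ => hnonneg y l) (mul_nonneg (hβ0 j) (hnonneg x j))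
  have hPx : P x i = β i := by
    have hprod : ∏ l ∈ G.neighborFinset i, (1 - (if x l then 1 else 0) : ℝ) = 1 :=
      Finset.prod_eq_one fun l hl => by simp [hxN l ((G.mem_neighborFinset i l).mp hl)]
    simp only [hP, hprod]
    simp [hxi]
  have hPy : P y i = 0 := by
    rcases Finset.mem_insert.mp hk with rfl | hk
    · simp [hP, hyk]
    · exact mul_eq_zero_of_right _ (Finset.prod_eq_zero hk (by simp [hyk]))
  have hpen : (∑ j, P y j) + β i ≤ ∑ j, P x j := by
    rw [← Finset.add_sum_erase _ (P y) (Finset.mem_univ i),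
      ← Finset.add_sum_erase _ (P x) (Finset.mem_univ i), hPx, hPy]
    linarith [Finset.sum_le_sum fun j (_ : j ∈ Finset.univ.erase i) => hPle j]
  have hxy := hmin y
  rw [hf x, hf y, hlin] at hxy
  change _ + ∑ j, P x j ≤ _ + ∑ j, P y j at hxy
  linarith
end

section
/- Let G = (V, E) be a finite simple undirected graph on V = {1,…,n} with real edge weights w_{ij} and vertex degrees d_i = |N(i)|, and let D_0 ≤ D_1 be nonnegative integers with D_0 ≤ Σ_{i=1}^n d_i and D_1 − D_0 ≥ max_i d_i. Define cut(x) = Σ_{{i,j}∈E} w_{ij}·(x_i(1−x_j) + x_j(1−x_i)) and the energy f(x) = cut(x) + β·(Σ_{i=1}^n d_i x_i − D_1)_+ + β·(D_0 − Σ_{i=1}^n d_i x_i)_+, where (t)_+ = max{t, 0}. If β ≥ max_i Σ_{j∈N(i)} |w_{ij}|, then for any x ∈ {0,1}^n there exists x' ∈ {0,1}^n satisfying the volume constraint D_0 ≤ Σ_{i=1}^n d_i x'_i ≤ D_1 and f(x') ≤ f(x). -/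
/-- The cut value of `x`, summed over ordered adjacent pairs `i < j`. -/
noncomputable def cutValue {n : ℕ} (G : SimpleGraph (Fin n)) [DecidableRel G.Adj]
    (w : Fin n → Fin n → ℝ) (x : Fin n → ℝ) : ℝ :=
  ∑ i, ∑ j, if i < j ∧ G.Adj i j then w i j * (x i * (1 - x j) + x j * (1 - x i)) else 0

/-- Changing one coordinate of a binary vector changes the cut value by at most the total
absolute weight of the edges at that coordinate. -/
theorem abs_cutValue_sub_le {n : ℕ} (G : SimpleGraph (Fin n)) [DecidableRel G.Adj]
    (w : Fin n → Fin n → ℝ) (hw : ∀ i j, w i j = w j i) (k : Fin n) (x y : Fin n → ℝ)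
    (hx : ∀ i, x i = 0 ∨ x i = 1) (hy : ∀ i, y i = 0 ∨ y i = 1) (hxy : ∀ i, i ≠ k → y i = x i) :
    |cutValue G w y - cutValue G w x| ≤ ∑ j ∈ G.neighborFinset k, |w k j| := by
  have key : ∀ i j, |(if i < j ∧ G.Adj i j then
        w i j * (y i * (1 - y j) + y j * (1 - y i)) else 0) -
      (if i < j ∧ G.Adj i j then w i j * (x i * (1 - x j) + x j * (1 - x i)) else 0)| ≤
      (if i = k then (if k < j ∧ G.Adj k j then |w k j| else 0) else 0) +
      (if j = k then (if i < k ∧ G.Adj k i then |w k i| else 0) else 0) := by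
    intro i j
    by_cases hij : i < j ∧ G.Adj i j
    · have bound : |w i j * (y i * (1 - y j) + y j * (1 - y i)) -
          w i j * (x i * (1 - x j) + x j * (1 - x i))| ≤ |w i j| := by
        rcases hx i with h1 | h1 <;> rcases hx j with h2 | h2 <;>
          rcases hy i with h3 | h3 <;> rcases hy j with h4 | h4 <;> simp [h1, h2, h3, h4]
      rw [if_pos hij, if_pos hij]
      by_cases hi : i = k
      · subst hi
        simpa [hij, hij.1.ne'] using bound
      · by_cases hj : j = k
        · subst hj
          simpa [hi, hij.1, hij.2.symm, hw j i] using bound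
        · simp [hi, hj, hxy i hi, hxy j hj]
    · rw [if_neg hij, if_neg hij, sub_zero, abs_zero]
      positivity
  unfold cutValue
  simp_rw [← Finset.sum_sub_distrib]
  calc _ ≤ ∑ i, ∑ j, ((if i = k then (if k < j ∧ G.Adj k j then |w k j| else 0) else 0) +
      (if j = k then (if i < k ∧ G.Adj k i then |w k i| else 0) else 0)) :=
        (Finset.abs_sum_le_sum_abs _ _).trans <| Finset.sum_le_sum fun i _ =>
          (Finset.abs_sum_le_sum_abs _ _).trans <| Finset.sum_le_sum fun j _ => key i j
    _ = ∑ j, ((if k < j ∧ G.Adj k j then |w k j| else 0) +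
          (if j < k ∧ G.Adj k j then |w k j| else 0)) := by
        simp_rw [Finset.sum_add_distrib]
        congr 1
        · rw [Finset.sum_comm]
          simp
        · simp
    _ = ∑ j ∈ G.neighborFinset k, |w k j| := by
        rw [SimpleGraph.neighborFinset_eq_filter, Finset.sum_filter]
        refine Finset.sum_congr rfl fun j _ => ?_
        by_cases h : G.Adj k j
        · rcases lt_or_gt_of_ne h.ne with hlt | hlt <;> simp [h, hlt, not_lt_of_gt hlt]
        · simp [h]

/-- A set function `c` penalized, with slope `β`, for leaving the range `[D₀, D₁]` of the
total size `∑ i ∈ S, d i`. -/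
noncomputable def penalizedEnergy {ι : Type*} (d : ι → ℕ) (c : Finset ι → ℝ) (D₀ D₁ : ℕ) (β : ℝ)
    (S : Finset ι) : ℝ :=
  c S + β * max (((∑ i ∈ S, d i : ℕ) : ℝ) - D₁) 0 + β * max ((D₀ : ℝ) - (∑ i ∈ S, d i : ℕ)) 0

section Improvement

variable {ι : Type*} [DecidableEq ι] {d : ι → ℕ} {c : Finset ι → ℝ} {D₀ D₁ : ℕ} {β : ℝ}

theorem exists_penalizedEnergy_le_of_le_sum (hβ : ι → 0 ≤ β) (hd : ∀ i, D₀ + d i ≤ D₁)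
    (hc : ∀ (S : Finset ι) (k : ι), k ∉ S → |c (insert k S) - c S| ≤ β) (S : Finset ι)
    (hS : D₀ ≤ ∑ i ∈ S, d i) :
    ∃ T : Finset ι, D₀ ≤ ∑ i ∈ T, d i ∧ ∑ i ∈ T, d i ≤ D₁ ∧
      penalizedEnergy d c D₀ D₁ β T ≤ penalizedEnergy d c D₀ D₁ β S := by
  induction S using Finset.strongInduction with
  | H S ih =>
    by_cases h : ∑ i ∈ S, d i ≤ D₁
    · exact ⟨S, hS, h, le_rfl⟩
    have hpos : ∑ i ∈ S, d i ≠ 0 := by omega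
    obtain ⟨k, hk, hdk⟩ := Finset.exists_ne_zero_of_sum_ne_zero hpos
    have hsum := Finset.add_sum_erase S d hk
    have hlow : D₀ ≤ ∑ i ∈ S.erase k, d i := by have := hd k; omega
    obtain ⟨T, h0, h1, hT⟩ := ih _ (Finset.erase_ssubset hk) hlow
    refine ⟨T, h0, h1, hT.trans ?_⟩
    have hcut := hc (S.erase k) k (Finset.notMem_erase k S)
    rw [Finset.insert_erase hk] at hcut
    unfold penalizedEnergy
    have e1 : max ((D₀ : ℝ) - (∑ i ∈ S.erase k, d i : ℕ)) 0 = 0 :=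
      max_eq_right (sub_nonpos.2 (by exact_mod_cast hlow))
    have e2 : max ((D₀ : ℝ) - (∑ i ∈ S, d i : ℕ)) 0 = 0 :=
      max_eq_right (sub_nonpos.2 (by exact_mod_cast hS))
    have e3 : max (((∑ i ∈ S.erase k, d i : ℕ) : ℝ) - D₁) 0 + 1 ≤
        max (((∑ i ∈ S, d i : ℕ) : ℝ) - D₁) 0 := by
      have a1 : ((∑ i ∈ S.erase k, d i : ℕ) : ℝ) + 1 ≤ (∑ i ∈ S, d i : ℕ) := by
        exact_mod_cast (by omega : ∑ i ∈ S.erase k, d i + 1 ≤ ∑ i ∈ S, d i)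
      have a2 : (D₁ : ℝ) + 1 ≤ (∑ i ∈ S, d i : ℕ) := by
        exact_mod_cast (by omega : D₁ + 1 ≤ ∑ i ∈ S, d i)
      rw [← le_sub_iff_add_le]
      refine max_le ?_ ?_ <;> linarith [le_max_left (((∑ i ∈ S, d i : ℕ) : ℝ) - D₁) 0]
    rw [e1, e2]
    linarith [mul_le_mul_of_nonneg_left e3 (hβ k), (abs_le.1 hcut).1]

theorem exists_penalizedEnergy_le_of_sum_le [Fintype ι] (hβ : ι → 0 ≤ β)
    (hd : ∀ i, D₀ + d i ≤ D₁) (hD₀ : D₀ ≤ ∑ i, d i)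
    (hc : ∀ (S : Finset ι) (k : ι), k ∉ S → |c (insert k S) - c S| ≤ β) (S : Finset ι)
    (hS : ∑ i ∈ S, d i ≤ D₁) :
    ∃ T : Finset ι, D₀ ≤ ∑ i ∈ T, d i ∧ ∑ i ∈ T, d i ≤ D₁ ∧
      penalizedEnergy d c D₀ D₁ β T ≤ penalizedEnergy d c D₀ D₁ β S := by
  induction S using WellFoundedGT.induction with
  | ind S ih =>
    by_cases h : D₀ ≤ ∑ i ∈ S, d i
    · exact ⟨S, h, hS, le_rfl⟩
    have hpos : ∑ i ∈ Sᶜ, d i ≠ 0 := by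
      have := Finset.sum_add_sum_compl S d
      omega
    obtain ⟨k, hk, hdk⟩ := Finset.exists_ne_zero_of_sum_ne_zero hpos
    rw [Finset.mem_compl] at hk
    have hsum := Finset.sum_insert (f := d) hk
    have hup : ∑ i ∈ insert k S, d i ≤ D₁ := by have := hd k; omega
    obtain ⟨T, h0, h1, hT⟩ := ih _ (Finset.ssubset_insert hk) hup
    refine ⟨T, h0, h1, hT.trans ?_⟩
    have hcut := hc S k hk
    unfold penalizedEnergy
    have e1 : max (((∑ i ∈ insert k S, d i : ℕ) : ℝ) - D₁) 0 = 0 :=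
      max_eq_right (sub_nonpos.2 (by exact_mod_cast hup))
    have e2 : max (((∑ i ∈ S, d i : ℕ) : ℝ) - D₁) 0 = 0 :=
      max_eq_right (sub_nonpos.2 (by exact_mod_cast hS))
    have e3 : max ((D₀ : ℝ) - (∑ i ∈ insert k S, d i : ℕ)) 0 + 1 ≤
        max ((D₀ : ℝ) - (∑ i ∈ S, d i : ℕ)) 0 := by
      have a1 : ((∑ i ∈ S, d i : ℕ) : ℝ) + 1 ≤ (∑ i ∈ insert k S, d i : ℕ) := by
        exact_mod_cast (by omega : ∑ i ∈ S, d i + 1 ≤ ∑ i ∈ insert k S, d i)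
      have a2 : ((∑ i ∈ S, d i : ℕ) : ℝ) + 1 ≤ D₀ := by
        exact_mod_cast (by omega : ∑ i ∈ S, d i + 1 ≤ D₀)
      rw [← le_sub_iff_add_le]
      refine max_le ?_ ?_ <;> linarith [le_max_left ((D₀ : ℝ) - (∑ i ∈ S, d i : ℕ)) 0]
    rw [e1, e2]
    linarith [mul_le_mul_of_nonneg_left e3 (hβ k), (abs_le.1 hcut).2]

end Improvement

/-- For the penalized minimum cut energy
f(x) = cut(x) + β(Σ_i d_i x_i − D₁)₊ + β(D₀ − Σ_i d_i x_i)₊ with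
β ≥ max_i Σ_{j∈N(i)} |w_{ij}|, D₀ ≤ D₁, D₀ ≤ Σ_i d_i and D₁ − D₀ ≥ max_i d_i,
every binary x can be improved to a binary x' satisfying the volume constraint
D₀ ≤ Σ_i d_i x'_i ≤ D₁ with f(x') ≤ f(x). -/
theorem mincut_energy_improvable (n : ℕ) (G : SimpleGraph (Fin n)) [DecidableRel G.Adj]
    (w : Fin n → Fin n → ℝ) (hwsym : ∀ i j, w i j = w j i)
    (D₀ D₁ : ℕ) (hD : D₀ ≤ D₁)
    (hD₀ : D₀ ≤ ∑ i, G.degree i)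
    (hgap : ∀ i, G.degree i ≤ D₁ - D₀)
    (β : ℝ) (hβ : ∀ i, ∑ j ∈ G.neighborFinset i, |w i j| ≤ β)
    (cut : (Fin n → ℝ) → ℝ)
    (hcut : ∀ x, cut x = ∑ i, ∑ j, if i < j ∧ G.Adj i j then
      w i j * (x i * (1 - x j) + x j * (1 - x i)) else 0)
    (f : (Fin n → ℝ) → ℝ)
    (hf : ∀ x, f x = cut x +
      β * max ((∑ i, (G.degree i : ℝ) * x i) - (D₁ : ℝ)) 0 +
      β * max ((D₀ : ℝ) - ∑ i, (G.degree i : ℝ) * x i) 0)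
    (x : Fin n → ℝ) (hx : ∀ i, x i = 0 ∨ x i = 1) :
    ∃ x' : Fin n → ℝ, (∀ i, x' i = 0 ∨ x' i = 1) ∧
      (D₀ : ℝ) ≤ (∑ i, (G.degree i : ℝ) * x' i) ∧
      (∑ i, (G.degree i : ℝ) * x' i) ≤ (D₁ : ℝ) ∧
      f x' ≤ f x := by
  let e : Finset (Fin n) → Fin n → ℝ := fun S i => if i ∈ S then 1 else 0
  have he : ∀ S i, e S i = 0 ∨ e S i = 1 := fun S i => by
    by_cases h : i ∈ S <;> simp [e, h]
  have hvol : ∀ S, ∑ i, (G.degree i : ℝ) * e S i = (∑ i ∈ S, G.degree i : ℕ) := fun S => by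
    simp [e]
  let E := penalizedEnergy (fun i => G.degree i) (fun S => cutValue G w (e S)) D₀ D₁ β
  have hE : ∀ S, f (e S) = E S := fun S => by
    rw [hf, hcut, hvol]
    rfl
  have hβ0 : Fin n → 0 ≤ β := fun i =>
    (Finset.sum_nonneg fun j _ => abs_nonneg (w i j)).trans (hβ i)
  have hd : ∀ i, D₀ + G.degree i ≤ D₁ := fun i => by
    have := hgap i
    omega
  have hc : ∀ (S : Finset (Fin n)) (k : Fin n), k ∉ S →
      |cutValue G w (e (insert k S)) - cutValue G w (e S)| ≤ β := fun S k _ =>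
    (abs_cutValue_sub_le G w hwsym k _ _ (he S) (he _)
      fun i hi => by simp [e, hi]).trans (hβ k)
  obtain ⟨S, rfl⟩ : ∃ S, x = e S := by
    refine ⟨Finset.univ.filter fun i => x i = 1, funext fun i => ?_⟩
    rcases hx i with h | h <;> simp [e, h]
  obtain ⟨T, h0, h1, hT⟩ : ∃ T : Finset (Fin n), D₀ ≤ ∑ i ∈ T, G.degree i ∧
      ∑ i ∈ T, G.degree i ≤ D₁ ∧ E T ≤ E S := by
    rcases le_total D₀ (∑ i ∈ S, G.degree i) with h | h
    · exact exists_penalizedEnergy_le_of_le_sum hβ0 hd hc S h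
    · exact exists_penalizedEnergy_le_of_sum_le hβ0 hd hD₀ hc S (h.trans hD)
  refine ⟨e T, he T, ?_, ?_, ?_⟩
  · rw [hvol]
    exact_mod_cast h0
  · rw [hvol]
    exact_mod_cast h1
  · rw [hE, hE]
    exact hT
end
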